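/- There is no 1-dependent proper 4-coloring X of the 3-ray star graph S^3 satisfying both: (i) the law of X is invariant under every permutation of the 4 colors; and (ii) for each pair i ≠ j ∈ {1,2,3}, the restriction of X to the bi-infinite path v^i v_0 v^j (indexed by ℤ, passing along ray i, through v_0, and along ray j) is a 1-dependent proper 4-coloring of ℤ whose law is invariant under permutations of the colors, under translations of ℤ, and under reflection of ℤ. -/

import Mathlib

open MeasureTheory ProbabilityTheory

/-- A process `X` indexed by the vertices of a graph `G` is *1-dependent* if its
restrictions to any two vertex sets at graph distance greater than 1 (i.e. containing
no common and no adjacent vertices) are independent. -/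
def OneDependent {V E Ω : Type*} [MeasurableSpace E] (G : SimpleGraph V)
    [MeasurableSpace Ω] (μ : Measure Ω) (X : V → Ω → E) : Prop :=
  ∀ A B : Set V, (∀ a ∈ A, ∀ b ∈ B, a ≠ b ∧ ¬G.Adj a b) →
    IndepFun (fun ω (a : A) => X a.1 ω) (fun ω (b : B) => X b.1 ω) μ

/-- A `{0,1}`-valued process is a *hard-core process* on `G` if almost surely no two
adjacent vertices both take the value `1` (`true`). -/
def HardCore {V Ω : Type*} (G : SimpleGraph V) [MeasurableSpace Ω]
    (μ : Measure Ω) (J : V → Ω → Bool) : Prop :=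
  ∀ u v, G.Adj u v → μ {ω | J u ω = true ∧ J v ω = true} = 0

/-- The critical point `p_h(G)`: the supremum of all `p` for which a 1-dependent
hard-core process on `G` with marginals `P(J_v = 1) = p` exists. -/
noncomputable def pCrit {V : Type*} (G : SimpleGraph V) : ℝ :=
  sSup {p : ℝ | ∃ (Ω : Type) (_ : MeasurableSpace Ω) (μ : Measure Ω),
    IsProbabilityMeasure μ ∧ ∃ J : V → Ω → Bool,
      (∀ v, Measurable (J v)) ∧ HardCore G μ J ∧ OneDependent G μ J ∧
      ∀ v, (μ {ω | J v ω = true}).toReal = p}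

/-- The `d`-ray star graph: a distinguished vertex `none`, and `d` infinite rays;
`some (i, k)` is the `(k+1)`-st vertex of ray `i`. -/
def starGraph (d : ℕ) : SimpleGraph (Option (Fin d × ℕ)) :=
  SimpleGraph.fromRel (fun u v =>
    (∃ i, u = none ∧ v = some (i, 0)) ∨ (∃ i k, u = some (i, k) ∧ v = some (i, k + 1)))

/-- The bi-infinite path graph on `ℤ`: `n` is adjacent to `n + 1`. -/
def zPath : SimpleGraph ℤ := SimpleGraph.fromRel (fun m n => n = m + 1)

/-- The bi-infinite path `v^i v_0 v^j` inside the 3-ray star graph, indexed by `ℤ`: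
negative integers go along ray `i`, `0` is the center, positive integers go along
ray `j`. -/
def rayEmbed (i j : Fin 3) (n : ℤ) : Option (Fin 3 × ℕ) :=
  if 0 < n then some (j, (n - 1).toNat)
  else if n < 0 then some (i, (-n - 1).toNat)
  else none

/-- Boolean version of adjacency in the star graph. -/
def starAdjB : Option (Fin 3 × ℕ) → Option (Fin 3 × ℕ) → Bool
  | none, none => false
  | none, some (_, k) => k == 0
  | some (_, k), none => k == 0
  | some (i, k), some (j, l) => i == j && (l == k + 1 || k == l + 1)

theorem starAdjB_iff (u v : Option (Fin 3 × ℕ)) :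
    (starGraph 3).Adj u v ↔ starAdjB u v = true := by
  unfold starGraph
  rw [SimpleGraph.fromRel_adj]
  rcases u with _ | ⟨i, k⟩ <;> rcases v with _ | ⟨j, l⟩ <;> simp [starAdjB]
  grind

/-- The event that no vertex of `S` has color `0`. -/
def avoidEv {V Ω : Type*} (X : V → Ω → Fin 4) (S : Finset V) : Set Ω :=
  {ω | ∀ u ∈ S, X u ω ≠ 0}

theorem avoidEv_measurable {V Ω : Type*} [MeasurableSpace Ω] {X : V → Ω → Fin 4}
    (hX : ∀ v, Measurable (X v)) (S : Finset V) : MeasurableSet (avoidEv X S) := by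
  have : avoidEv X S = ⋂ u ∈ S, X u ⁻¹' {0}ᶜ := by
    ext ω; simp [avoidEv]
  rw [this]
  exact Finset.measurableSet_biInter _ fun u _ => hX u (MeasurableSet.of_discrete)

theorem avoid_set_meas {V : Type*} (S : Finset V) :
    MeasurableSet {f : ↥(S : Set V) → Fin 4 | ∀ u, f u ≠ 0} := by
  rw [Set.ofPred_forall]
  exact MeasurableSet.iInter fun u => (measurable_pi_apply u) (MeasurableSet.of_discrete (s := {0}ᶜ))

theorem avoid_mul {Ω : Type*} [MeasurableSpace Ω] {μ : Measure Ω}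
    {X : Option (Fin 3 × ℕ) → Ω → Fin 4} (hd : OneDependent (starGraph 3) μ X)
    (A B : Finset (Option (Fin 3 × ℕ)))
    (h : ∀ a ∈ A, ∀ b ∈ B, a ≠ b ∧ starAdjB a b = false) :
    μ.real (avoidEv X (A ∪ B)) = μ.real (avoidEv X A) * μ.real (avoidEv X B) := by
  have hi := hd (A : Set _) (B : Set _) (fun a ha b hb => by
    have := h a ha b hb
    rw [starAdjB_iff]; simpa using this)
  have := hi.measure_inter_preimage_eq_mul _ _ (avoid_set_meas A) (avoid_set_meas B)
  rw [measureReal_def, measureReal_def, measureReal_def, ← ENNReal.toReal_mul]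
  convert congrArg ENNReal.toReal this using 3
  · ext ω
    simp [avoidEv, or_imp, forall_and, -Prod.forall]
  · congr 1; ext ω; simp [avoidEv, -Prod.forall]
  · congr 1; ext ω; simp [avoidEv, -Prod.forall]

theorem avoid_rec {Ω : Type*} [MeasurableSpace Ω] {μ : Measure Ω} [IsProbabilityMeasure μ]
    {X : Option (Fin 3 × ℕ) → Ω → Fin 4} (hX : ∀ v, Measurable (X v))
    (hp : ∀ u v, (starGraph 3).Adj u v → μ {ω | X u ω = X v ω} = 0)
    (hd : OneDependent (starGraph 3) μ X)
    (hq : ∀ v, μ.real (X v ⁻¹' {0}) = 1 / 4)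
    (v : Option (Fin 3 × ℕ)) (S T : Finset (Option (Fin 3 × ℕ))) (hTS : T ⊆ S)
    (hT : ∀ u ∈ T, v ≠ u ∧ starAdjB v u = false)
    (hS : ∀ u ∈ S, u ∉ T → starAdjB v u = true) :
    μ.real (avoidEv X (insert v S)) = μ.real (avoidEv X S) - 1 / 4 * μ.real (avoidEv X T) := by
  have hi := hd {v} (T : Set _) (fun a ha b hb => by
    have := hT b hb
    rw [Set.mem_singleton_iff.1 ha, starAdjB_iff]; simpa using this)
  have h1 := hi.measure_inter_preimage_eq_mul {f | f ⟨v, rfl⟩ = 0} _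
    ((measurable_pi_apply _) (MeasurableSet.of_discrete (s := {0}))) (avoid_set_meas T)
  have h2 : μ.real (X v ⁻¹' {0} ∩ avoidEv X T) = 1 / 4 * μ.real (avoidEv X T) := by
    rw [← hq v, measureReal_def, measureReal_def, measureReal_def, ← ENNReal.toReal_mul]
    convert congrArg ENNReal.toReal h1 using 3
    · ext ω
      simp [avoidEv, -Prod.forall]
    · congr 1
    · congr 1; ext ω; simp [avoidEv, -Prod.forall]
  have h3 : μ.real (avoidEv X S ∩ X v ⁻¹' {0}) = μ.real (X v ⁻¹' {0} ∩ avoidEv X T) := by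
    apply measureReal_congr
    have hae : ∀ᵐ ω ∂μ, ∀ u ∈ S, u ∉ T → X v ω ≠ X u ω := by
      rw [Filter.eventually_all_finset]
      intro u hu
      by_cases hut : u ∈ T
      · simp [hut]
      · have := hp v u ((starAdjB_iff v u).2 (hS u hu hut))
        simpa [hut, ae_iff] using this
    filter_upwards [hae] with ω hω
    apply propext
    constructor
    · rintro ⟨ha, hb⟩
      exact ⟨hb, fun u hu => ha u (hTS hu)⟩
    · rintro ⟨hb, ha⟩
      refine ⟨fun u hu => ?_, hb⟩
      by_cases hut : u ∈ T
      · exact ha u hut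
      · have := hω u hu hut
        have hb' : X v ω = 0 := hb
        rw [hb'] at this
        exact this.symm
  have h4 := measureReal_inter_add_sdiff (μ := μ) (s := avoidEv X S) (hX v (MeasurableSet.of_discrete (s := {0})))
  have h5 : avoidEv X S \ X v ⁻¹' {0} = avoidEv X (insert v S) := by
    ext ω
    simp only [avoidEv, Set.mem_sdiff, Set.mem_ofPred_eq, Finset.mem_insert, forall_eq_or_imp,
      Set.mem_preimage, Set.mem_singleton_iff]
    exact and_comm
  rw [h5] at h4
  linarith

theorem marginal_quarter {V Ω : Type*} [MeasurableSpace Ω] {μ : Measure Ω}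
    [IsProbabilityMeasure μ] {X : V → Ω → Fin 4} (hX : ∀ v, Measurable (X v))
    (hs : ∀ σ : Equiv.Perm (Fin 4),
          Measure.map (fun ω (v : V) => σ (X v ω)) μ = Measure.map (fun ω (v : V) => X v ω) μ)
    (v : V) : μ.real (X v ⁻¹' {0}) = 1 / 4 := by
  have hc : ∀ c : Fin 4, μ.real (X v ⁻¹' {c}) = μ.real (X v ⁻¹' {0}) := by
    intro c
    have hm : MeasurableSet {f : V → Fin 4 | f v = 0} :=
      (measurable_pi_apply v) (MeasurableSet.of_discrete (s := {0}))
    have := congrArg (fun m => m {f : V → Fin 4 | f v = 0}) (hs (Equiv.swap 0 c))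
    have hmeas : Measurable (fun ω (v : V) => Equiv.swap 0 c (X v ω)) :=
      measurable_pi_lambda _ fun v =>
        (Measurable.of_discrete (f := Equiv.swap 0 c)).comp (hX v)
    rw [Measure.map_apply hmeas hm,
      Measure.map_apply (measurable_pi_lambda _ hX) hm] at this
    rw [measureReal_def, measureReal_def]
    convert congrArg ENNReal.toReal this using 3
    · ext ω
      simp [Equiv.swap_apply_eq_iff]
    · rfl
  have hsum : ∑ c : Fin 4, μ.real (X v ⁻¹' {c}) = 1 := by
    have h := sum_measureReal_preimage_singleton (μ := μ) (f := X v) Finset.univ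
      (fun c _ => hX v (MeasurableSet.of_discrete))
    rw [h]; simp
  simp only [hc] at hsum
  simp at hsum
  linarith

/-- There is no 1-dependent proper 4-coloring `X` of the 3-ray star
graph such that (i) the law of `X` is invariant under all permutations of the four
colors, and (ii) for each `i ≠ j`, the restriction of `X` to the bi-infinite path
`v^i v_0 v^j` is a 1-dependent proper 4-coloring of `ℤ` whose law is invariant under
color permutations, translations and reflection. -/
theorem no_symmetric_four_coloring :
    ¬ ∃ (Ω : Type) (_ : MeasurableSpace Ω) (μ : Measure Ω),
      IsProbabilityMeasure μ ∧ ∃ X : Option (Fin 3 × ℕ) → Ω → Fin 4,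
        (∀ v, Measurable (X v)) ∧
        (∀ u v, (starGraph 3).Adj u v → μ {ω | X u ω = X v ω} = 0) ∧
        OneDependent (starGraph 3) μ X ∧
        (∀ σ : Equiv.Perm (Fin 4),
          Measure.map (fun ω (v : Option (Fin 3 × ℕ)) => σ (X v ω)) μ
            = Measure.map (fun ω (v : Option (Fin 3 × ℕ)) => X v ω) μ) ∧
        (∀ i j : Fin 3, i ≠ j →
          OneDependent zPath μ (fun n ω => X (rayEmbed i j n) ω) ∧
          (∀ u v : ℤ, zPath.Adj u v →
            μ {ω | X (rayEmbed i j u) ω = X (rayEmbed i j v) ω} = 0) ∧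
          (∀ σ : Equiv.Perm (Fin 4),
            Measure.map (fun ω (n : ℤ) => σ (X (rayEmbed i j n) ω)) μ
              = Measure.map (fun ω (n : ℤ) => X (rayEmbed i j n) ω) μ) ∧
          (Measure.map (fun ω (n : ℤ) => X (rayEmbed i j (n + 1)) ω) μ
              = Measure.map (fun ω (n : ℤ) => X (rayEmbed i j n) ω) μ) ∧
          (Measure.map (fun ω (n : ℤ) => X (rayEmbed i j (-n)) ω) μ
              = Measure.map (fun ω (n : ℤ) => X (rayEmbed i j n) ω) μ)) := by
  rintro ⟨Ω, _, μ, _, X, hX, hp, hd, hs, -⟩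
  have hq := marginal_quarter hX hs
  have hrec := avoid_rec hX hp hd hq
  have hmul := avoid_mul hd
  have h0 : μ.real (avoidEv X ∅) = 1 := by simp [avoidEv]
  have r1 : ∀ i k, μ.real (avoidEv X {some (i, k)}) = 3 / 4 := by
    intro i k
    have := hrec (some (i, k)) ∅ ∅ (by simp) (by simp) (by simp)
    rw [h0] at this
    rw [← insert_empty_eq, this]; norm_num
  have r2 : ∀ i, μ.real (avoidEv X {some (i, 1), some (i, 2)}) = 1 / 2 := by
    intro i
    have := hrec (some (i, 1)) {some (i, 2)} ∅ (by simp) (by simp) (by simp [starAdjB])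
    rw [this, h0, r1]; norm_num
  have r3 : ∀ i, μ.real (avoidEv X {some (i, 0), some (i, 1), some (i, 2)}) = 5 / 16 := by
    intro i
    have := hrec (some (i, 0)) {some (i, 1), some (i, 2)} {some (i, 2)} (by simp)
      (by simp [starAdjB]) (by simp [starAdjB])
    rw [this, r2, r1]; norm_num
  have t2 := hmul {some (0, 1), some (0, 2)}
    ({some (1, 1), some (1, 2)} ∪ {some (2, 1), some (2, 2)}) (by decide)
  rw [r2, hmul {some (1, 1), some (1, 2)} {some (2, 1), some (2, 2)} (by decide), r2, r2] at t2
  have t3 := hmul {some (0, 0), some (0, 1), some (0, 2)}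
    ({some (1, 0), some (1, 1), some (1, 2)} ∪ {some (2, 0), some (2, 1), some (2, 2)}) (by decide)
  rw [r3, hmul {some (1, 0), some (1, 1), some (1, 2)} {some (2, 0), some (2, 1), some (2, 2)} (by decide), r3, r3] at t3
  have fin := hrec none
    ({some (0, 0), some (0, 1), some (0, 2)} ∪
      ({some (1, 0), some (1, 1), some (1, 2)} ∪ {some (2, 0), some (2, 1), some (2, 2)}))
    ({some (0, 1), some (0, 2)} ∪
      ({some (1, 1), some (1, 2)} ∪ {some (2, 1), some (2, 2)}))
    (by decide) (by decide) (by decide)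
  rw [t2, t3] at fin
  have hnn := measureReal_nonneg (μ := μ) (s := avoidEv X (insert none
    ({some (0, 0), some (0, 1), some (0, 2)} ∪
      ({some (1, 0), some (1, 1), some (1, 2)} ∪ {some (2, 0), some (2, 1), some (2, 2)}))))
  rw [fin] at hnn
  norm_num at hnn
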